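/- arXiv:math/9902138 — 3 statements merged into one kernel-verified Lean document; each statement's English description precedes it below -/
import Mathlib

section
/- Let u₀ ∈ ℝ, γ ∈ (0,1), and let u₁, u₂ : ℝ × ℝ → ℝ be smooth functions, 1-periodic in q, satisfying (u₁)_t = 2u₀·(u₁)_q − (u₂)_q and (u₂)_t = u₁·(u₁)_q, with u₁(q,t) > u₀² everywhere. Define E(t) = ∫₀¹ u₁(q,t)^γ dq. Then E is twice differentiable with E''(t) = γ(γ−1) ∫₀¹ u₁^{γ−2} ( (u₁)_t² − 2u₀·(u₁)_t·(u₁)_q + (u₁)_q² ) dq ≤ 0; in particular E is a positive concave function on ℝ. -/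
open Set

/-- Differentiation under the integral sign for a `C¹` integrand over a bounded interval. -/
lemma hasDerivAt_intervalIntegral_of_continuous {F F' : ℝ → ℝ → ℝ} {a b : ℝ}
    (hF : ∀ q t, HasDerivAt (F q) (F' q t) t)
    (hFc : Continuous fun x : ℝ × ℝ => F x.1 x.2)
    (hF'c : Continuous fun x : ℝ × ℝ => F' x.1 x.2) (t : ℝ) :
    HasDerivAt (fun s => ∫ q in a..b, F q s) (∫ q in a..b, F' q t) t := by
  obtain ⟨C, hC⟩ := ((isCompact_uIcc (a := a) (b := b)).prod
    (isCompact_closedBall t 1)).exists_bound_of_continuousOn hF'c.continuousOn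
  refine (intervalIntegral.hasDerivAt_integral_of_dominated_loc_of_deriv_le (F := fun s q => F q s)
    (F' := fun s q => F' q s) (s := Metric.closedBall t 1) (bound := fun _ => C)
    (Metric.closedBall_mem_nhds t one_pos) (.of_forall fun s => ?_) ?_ ?_ ?_ ?_ ?_).2
  · exact (hFc.comp (by fun_prop : Continuous fun q : ℝ => (q, s))).aestronglyMeasurable
  · exact (hFc.comp (by fun_prop : Continuous fun q : ℝ => (q, t))).intervalIntegrable _ _
  · exact (hF'c.comp (by fun_prop : Continuous fun q : ℝ => (q, t))).aestronglyMeasurable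
  · exact .of_forall fun q hq s hs => hC (q, s) ⟨uIoc_subset_uIcc hq, hs⟩
  · exact continuous_const.intervalIntegrable _ _
  · exact .of_forall fun q _ s _ => hF q s

lemma intervalIntegral_eq_zero_of_hasDerivAt {f f' : ℝ → ℝ} {a b : ℝ}
    (hf : ∀ q, HasDerivAt f (f' q) q) (hf' : Continuous f') (hab : f b = f a) :
    ∫ q in a..b, f' q = 0 := by
  rw [intervalIntegral.integral_eq_sub_of_hasDerivAt (fun q _ => hf q)
    (hf'.intervalIntegrable _ _), hab, sub_self]

/-- A differentiable function on `ℝ` with monotone derivative that is bounded above has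
vanishing derivative. -/
lemma hasDerivAt_eq_zero_of_monotone_of_le {f f' : ℝ → ℝ} {C : ℝ}
    (hf : ∀ t, HasDerivAt f (f' t) t) (hf' : Monotone f') (hC : ∀ t, f t ≤ C) (t : ℝ) :
    f' t = 0 := by
  have hderiv : deriv f = f' := funext fun t => (hf t).deriv
  have hconv : ConvexOn ℝ univ f :=
    (hderiv ▸ hf').convexOn_univ_of_deriv fun t => (hf t).differentiableAt
  have tangent (s : ℝ) : f t + f' t * (s - t) ≤ f s := by
    rcases lt_trichotomy s t with h | rfl | h
    · have := hconv.slope_le_of_hasDerivAt (mem_univ s) (mem_univ t) h (hf t)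
      rw [slope_def_field, div_le_iff₀ (by linarith)] at this
      linarith
    · simp
    · have := hconv.le_slope_of_hasDerivAt (mem_univ t) (mem_univ s) h (hf t)
      rw [slope_def_field, le_div_iff₀ (by linarith)] at this
      linarith
  by_contra h0
  have h1 := tangent (t + (C + 1 - f t) / f' t)
  have h2 := hC (t + (C + 1 - f t) / f' t)
  rw [add_sub_cancel_left, mul_div_cancel₀ _ h0] at h1
  linarith

section PartialDerivatives

variable {F : ℝ × ℝ → ℝ}

lemma hasDerivAt_fst_of_contDiff (hF : ContDiff ℝ (⊤ : ℕ∞) F) (q t : ℝ) :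
    HasDerivAt (fun q' => F (q', t)) (fderiv ℝ F (q, t) (1, 0)) q :=
  ((hF.differentiable (by simp)) (q, t)).hasFDerivAt.comp_hasDerivAt q
    ((hasDerivAt_id q).prodMk (hasDerivAt_const q t))

lemma hasDerivAt_snd_of_contDiff (hF : ContDiff ℝ (⊤ : ℕ∞) F) (q t : ℝ) :
    HasDerivAt (fun t' => F (q, t')) (fderiv ℝ F (q, t) (0, 1)) t :=
  ((hF.differentiable (by simp)) (q, t)).hasFDerivAt.comp_hasDerivAt t
    ((hasDerivAt_const t q).prodMk (hasDerivAt_id t))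

lemma contDiff_fderiv_apply_const (hF : ContDiff ℝ (⊤ : ℕ∞) F) (v : ℝ × ℝ) :
    ContDiff ℝ (⊤ : ℕ∞) fun x => fderiv ℝ F x v :=
  (hF.fderiv_right (m := (⊤ : ℕ∞)) (by simp)).clm_apply contDiff_const

lemma fderiv_fderiv_apply_comm (hF : ContDiff ℝ (⊤ : ℕ∞) F) (x v w : ℝ × ℝ) :
    fderiv ℝ (fun y => fderiv ℝ F y v) x w = fderiv ℝ (fun y => fderiv ℝ F y w) x v := by
  have hd : DifferentiableAt ℝ (fderiv ℝ F) x :=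
    (hF.fderiv_right (m := (⊤ : ℕ∞)) (by simp)).differentiable (by simp) x
  have hsymm : IsSymmSndFDerivAt ℝ F x :=
    hF.contDiffAt.isSymmSndFDerivAt (by
      rw [minSmoothness_of_isRCLikeNormedField]
      exact WithTop.coe_le_coe.2 (le_top : (2 : ℕ∞) ≤ ⊤))
  rw [fderiv_clm_apply hd (by fun_prop), fderiv_clm_apply hd (by fun_prop)]
  simpa using hsymm w v

end PartialDerivatives

lemma add_sq_sub_pos {a c x y : ℝ} (hc : a ^ 2 < c) (hxy : x ≠ 0 ∨ y ≠ 0) :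
    0 < x ^ 2 - 2 * a * x * y + c * y ^ 2 := by
  rcases eq_or_ne y 0 with rfl | hy
  · have hx : x ≠ 0 := by simpa using hxy
    simpa using pow_pos (abs_pos.2 hx) 2
  · nlinarith [sq_nonneg (x - a * y), mul_pos (sub_pos.2 hc) (pow_pos (abs_pos.2 hy) 2), sq_abs y]

/-- Every entire (in time) `q`-periodic solution in the elliptic region has constant `u₁` on a
period: `∫₀¹ exp (-u₁) dq` is convex and bounded in time, hence constant, and its second
derivative controls the gradient of `u₁`. -/
lemma elliptic_system_deriv_eq_zero {u₀ : ℝ} {u₁ u₂ : ℝ → ℝ → ℝ}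
    (h1 : ContDiff ℝ (⊤ : ℕ∞) (fun x : ℝ × ℝ => u₁ x.1 x.2))
    (h2 : ContDiff ℝ (⊤ : ℕ∞) (fun x : ℝ × ℝ => u₂ x.1 x.2))
    (hper1 : ∀ q t, u₁ (q + 1) t = u₁ q t)
    (hpde1 : ∀ q t, deriv (fun t' => u₁ q t') t =
      2 * u₀ * deriv (fun q' => u₁ q' t) q - deriv (fun q' => u₂ q' t) q)
    (hpde2 : ∀ q t, deriv (fun t' => u₂ q t') t = u₁ q t * deriv (fun q' => u₁ q' t) q)
    (hell : ∀ q t, u₁ q t > u₀ ^ 2) {q : ℝ} (hq : q ∈ Icc (0 : ℝ) 1) (t : ℝ) :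
    deriv (fun t' => u₁ q t') t = 0 ∧ deriv (fun q' => u₁ q' t) q = 0 := by
  set U : ℝ × ℝ → ℝ := fun x => u₁ x.1 x.2 with hU
  set V : ℝ × ℝ → ℝ := fun x => u₂ x.1 x.2 with hV
  set Uq : ℝ × ℝ → ℝ := fun x => fderiv ℝ U x (1, 0) with hUq_def
  set Ut : ℝ × ℝ → ℝ := fun x => fderiv ℝ U x (0, 1) with hUt_def
  set Vq : ℝ × ℝ → ℝ := fun x => fderiv ℝ V x (1, 0) with hVq_def
  set Vqt : ℝ × ℝ → ℝ := fun x => fderiv ℝ Vq x (0, 1) with hVqt_def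
  have dUq (q t : ℝ) : HasDerivAt (fun q' => u₁ q' t) (Uq (q, t)) q :=
    hasDerivAt_fst_of_contDiff h1 q t
  have dUt (q t : ℝ) : HasDerivAt (fun t' => u₁ q t') (Ut (q, t)) t :=
    hasDerivAt_snd_of_contDiff h1 q t
  have dVq (q t : ℝ) : HasDerivAt (fun q' => u₂ q' t) (Vq (q, t)) q :=
    hasDerivAt_fst_of_contDiff h2 q t
  have sVq : ContDiff ℝ (⊤ : ℕ∞) Vq := contDiff_fderiv_apply_const h2 _
  have dVqt (q t : ℝ) : HasDerivAt (fun t' => Vq (q, t')) (Vqt (q, t)) t :=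
    hasDerivAt_snd_of_contDiff sVq q t
  have cU : Continuous U := h1.continuous
  have cUq : Continuous Uq := (contDiff_fderiv_apply_const h1 _).continuous
  have cUt : Continuous Ut := (contDiff_fderiv_apply_const h1 _).continuous
  have cVq : Continuous Vq := sVq.continuous
  have cVqt : Continuous Vqt := (contDiff_fderiv_apply_const sVq _).continuous
  have pde1 (q t : ℝ) : Ut (q, t) = 2 * u₀ * Uq (q, t) - Vq (q, t) := by
    rw [← (dUt q t).deriv, hpde1, (dUq q t).deriv, (dVq q t).deriv]
  have pde2 (q t : ℝ) : fderiv ℝ V (q, t) (0, 1) = u₁ q t * Uq (q, t) := by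
    rw [← (dUq q t).deriv, ← hpde2]
    exact (hasDerivAt_snd_of_contDiff h2 q t).deriv.symm
  have dUUq (q t : ℝ) : HasDerivAt (fun q' => u₁ q' t * Uq (q', t)) (Vqt (q, t)) q := by
    have := hasDerivAt_fst_of_contDiff (contDiff_fderiv_apply_const h2 (0, 1)) q t
    rw [fderiv_fderiv_apply_comm h2] at this
    simpa only [pde2] using this
  have cslice (t : ℝ) : Continuous fun q : ℝ => (q, t) := by fun_prop
  have perU (t : ℝ) : u₁ 1 t = u₁ 0 t := by simpa using hper1 0 t
  have perUq (t : ℝ) : Uq (1, t) = Uq (0, t) := by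
    rw [← (dUq 1 t).deriv, ← (dUq 0 t).deriv]
    have := deriv_comp_add_const (fun q' => u₁ q' t) 1 0
    simpa [hper1] using this.symm
  let Q : ℝ × ℝ → ℝ := fun x => Real.exp (-U x) *
    (Ut x ^ 2 - 2 * u₀ * Ut x * Uq x + U x * Uq x ^ 2)
  have cQ : Continuous Q := by fun_prop
  have Q_nonneg (x : ℝ × ℝ) : 0 ≤ Q x := by
    by_cases h : Ut x ≠ 0 ∨ Uq x ≠ 0
    · exact (mul_pos (Real.exp_pos _) (add_sq_sub_pos (hell x.1 x.2) h)).le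
    · push Not at h
      simp [Q, h.1, h.2]
  have hG (t : ℝ) : HasDerivAt (fun s => ∫ q in (0 : ℝ)..1, Real.exp (-U (q, s)))
      (∫ q in (0 : ℝ)..1, Real.exp (-U (q, t)) * Vq (q, t)) t := by
    have h := hasDerivAt_intervalIntegral_of_continuous (a := 0) (b := 1)
      (F := fun q s => Real.exp (-U (q, s)))
      (F' := fun q s => Real.exp (-U (q, s)) * -Ut (q, s))
      (fun q s => (dUt q s).fun_neg.exp) (by fun_prop) (by fun_prop) t
    have hz : ∫ q in (0 : ℝ)..1, -(2 * u₀) * (Real.exp (-U (q, t)) * -Uq (q, t)) = 0 :=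
      intervalIntegral_eq_zero_of_hasDerivAt
        (f := fun q => -(2 * u₀) * Real.exp (-U (q, t)))
        (fun q => (dUq q t).fun_neg.exp.const_mul _) (by fun_prop) (by simp [hU, perU])
    convert h using 1
    rw [← sub_eq_zero, ← intervalIntegral.integral_sub]
    · refine Eq.trans ?_ hz
      congr 1 with q
      rw [pde1]
      ring
    all_goals exact Continuous.intervalIntegrable (by fun_prop) _ _
  have hG' (t : ℝ) : HasDerivAt (fun s => ∫ q in (0 : ℝ)..1, Real.exp (-U (q, s)) * Vq (q, s))
      (∫ q in (0 : ℝ)..1, Q (q, t)) t := by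
    have h := hasDerivAt_intervalIntegral_of_continuous (a := 0) (b := 1)
      (F := fun q s => Real.exp (-U (q, s)) * Vq (q, s))
      (F' := fun q s => Real.exp (-U (q, s)) * -Ut (q, s) * Vq (q, s) +
        Real.exp (-U (q, s)) * Vqt (q, s))
      (fun q s => (dUt q s).fun_neg.exp.mul (dVqt q s)) (by fun_prop) (by fun_prop) t
    have hz : ∫ q in (0 : ℝ)..1, (Real.exp (-U (q, t)) * -Uq (q, t) * (U (q, t) * Uq (q, t)) +
        Real.exp (-U (q, t)) * Vqt (q, t)) = 0 :=
      intervalIntegral_eq_zero_of_hasDerivAt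
        (f := fun q => Real.exp (-U (q, t)) * (U (q, t) * Uq (q, t)))
        (fun q => (dUq q t).fun_neg.exp.mul (dUUq q t)) (by fun_prop) (by simp [hU, perU, perUq])
    convert h using 1
    rw [eq_comm, ← sub_eq_zero, ← intervalIntegral.integral_sub]
    · refine Eq.trans ?_ hz
      congr 1 with q
      have : Vq (q, t) = 2 * u₀ * Uq (q, t) - Ut (q, t) := by linarith [pde1 q t]
      simp only [Q, this]
      ring
    all_goals exact Continuous.intervalIntegrable (by fun_prop) _ _
  have mono : Monotone fun s => ∫ q in (0 : ℝ)..1, Real.exp (-U (q, s)) * Vq (q, s) :=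
    monotone_of_hasDerivAt_nonneg hG' fun s =>
      intervalIntegral.integral_nonneg zero_le_one fun q _ => Q_nonneg (q, s)
  have bdd (s : ℝ) : ∫ q in (0 : ℝ)..1, Real.exp (-U (q, s)) ≤ 1 := by
    calc ∫ q in (0 : ℝ)..1, Real.exp (-U (q, s)) ≤ ∫ q in (0 : ℝ)..1, (1 : ℝ) := by
          refine intervalIntegral.integral_mono_on zero_le_one
            (Continuous.intervalIntegrable (by fun_prop) _ _) (by simp) fun q _ => ?_
          rw [Real.exp_le_one_iff, neg_nonpos]
          exact (sq_nonneg u₀).trans (hell q s).le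
      _ = 1 := by simp
  have hG'_zero : (fun s => ∫ q in (0 : ℝ)..1, Real.exp (-U (q, s)) * Vq (q, s)) = fun _ => 0 :=
    funext (hasDerivAt_eq_zero_of_monotone_of_le hG mono bdd)
  have hQ_zero : ∫ q in (0 : ℝ)..1, Q (q, t) = 0 :=
    (hG'_zero ▸ hG' t).unique (hasDerivAt_const t 0)
  rw [(dUt q t).deriv, (dUq q t).deriv]
  by_contra hne
  have hpos : 0 < Q (q, t) :=
    mul_pos (Real.exp_pos _) (add_sq_sub_pos (hell q t) (not_and_or.1 hne))
  exact (intervalIntegral.integral_pos zero_lt_one (cQ.comp (cslice t)).continuousOn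
    (fun q _ => Q_nonneg (q, t)) ⟨q, hq, hpos⟩).ne' hQ_zero


/-- With `u₀ ∈ ℝ`, `γ ∈ (0,1)` and `u₁, u₂` smooth, `1`-periodic in
`q`, solving `(u₁)_t = 2u₀(u₁)_q − (u₂)_q`, `(u₂)_t = u₁(u₁)_q`, and `u₁ > u₀²`
everywhere, the function `E(t) = ∫₀¹ u₁^γ dq` is twice differentiable with
`E'' = γ(γ−1) ∫₀¹ u₁^{γ−2}((u₁)_t² − 2u₀(u₁)_t(u₁)_q + (u₁)_q²) dq ≤ 0`;
in particular `E` is positive and concave on `ℝ`. -/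
theorem energy_of_elliptic_system_is_positive_concave
    (u₀ γ : ℝ) (hγ : γ ∈ Set.Ioo (0:ℝ) 1) (u₁ u₂ : ℝ → ℝ → ℝ)
    (h1 : ContDiff ℝ (⊤ : ℕ∞) (fun x : ℝ × ℝ => u₁ x.1 x.2))
    (h2 : ContDiff ℝ (⊤ : ℕ∞) (fun x : ℝ × ℝ => u₂ x.1 x.2))
    (hper1 : ∀ q t, u₁ (q + 1) t = u₁ q t)
    (hper2 : ∀ q t, u₂ (q + 1) t = u₂ q t)
    (hpde1 : ∀ q t, deriv (fun t' => u₁ q t') t =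
      2 * u₀ * deriv (fun q' => u₁ q' t) q - deriv (fun q' => u₂ q' t) q)
    (hpde2 : ∀ q t, deriv (fun t' => u₂ q t') t = u₁ q t * deriv (fun q' => u₁ q' t) q)
    (hell : ∀ q t, u₁ q t > u₀ ^ 2)
    (E : ℝ → ℝ) (hE : ∀ t, E t = ∫ q in (0:ℝ)..1, u₁ q t ^ γ) :
    ∃ E' E'' : ℝ → ℝ,
      (∀ t, HasDerivAt E (E' t) t) ∧
      (∀ t, HasDerivAt E' (E'' t) t) ∧
      (∀ t, E'' t = γ * (γ - 1) *
        ∫ q in (0:ℝ)..1, u₁ q t ^ (γ - 2) *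
          ((deriv (fun t' => u₁ q t') t) ^ 2
            - 2 * u₀ * deriv (fun t' => u₁ q t') t * deriv (fun q' => u₁ q' t) q
            + (deriv (fun q' => u₁ q' t) q) ^ 2)) ∧
      (∀ t, E'' t ≤ 0) ∧
      (∀ t, 0 < E t) ∧
      ConcaveOn ℝ Set.univ E := by
  have hzero {q : ℝ} (hq : q ∈ Icc (0 : ℝ) 1) (t : ℝ) :=
    elliptic_system_deriv_eq_zero h1 h2 hper1 hpde1 hpde2 hell hq t
  have hE_const : E = fun _ => E 0 := by
    funext t
    rw [hE, hE]
    refine intervalIntegral.integral_congr fun q hq => ?_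
    rw [uIcc_of_le zero_le_one] at hq
    have hdiff : Differentiable ℝ fun t' => u₁ q t' := fun s =>
      (hasDerivAt_snd_of_contDiff h1 q s).differentiableAt
    have hut : u₁ q t = u₁ q 0 :=
      is_const_of_deriv_eq_zero hdiff (fun s => (hzero hq s).1) t 0
    simp only [hut]
  have upos (q t : ℝ) : 0 < u₁ q t := (sq_nonneg u₀).trans_lt (hell q t)
  refine ⟨fun _ => 0, fun _ => 0, fun t => ?_, fun t => hasDerivAt_const t 0, fun t => ?_,
    fun _ => le_rfl, fun t => ?_, ?_⟩
  · rw [hE_const]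
    exact hasDerivAt_const t _
  · rw [intervalIntegral.integral_congr (g := fun _ => 0)]
    · simp
    · intro q hq
      rw [uIcc_of_le zero_le_one] at hq
      simp [(hzero hq t).1, (hzero hq t).2]
  · rw [hE]
    have hc : Continuous fun q => u₁ q t ^ γ :=
      (h1.continuous.comp (by fun_prop : Continuous fun q : ℝ => (q, t))).rpow_const
        fun q => Or.inl (upos q t).ne'
    exact intervalIntegral.intervalIntegral_pos_of_pos (hc.intervalIntegrable _ _)
      (fun q => Real.rpow_pos_of_pos (upos q t) γ) zero_lt_one
  · rw [hE_const]
    exact concaveOn_const _ convex_univ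
end

section
/- Fix n ≥ 1 and u₀ ∈ ℝ, and let u₁, …, u_n : ℝ × ℝ → ℝ be smooth functions (set u_{n+1} ≡ 0). Define F(p,q,t) = p^{n+1}/(n+1) + u₀·pⁿ + Σ_{k=1}^{n} u_k(q,t)·p^{n−k}. Then the functions u₁, …, u_n satisfy the quasi-linear system (u_k)_t = (n−k+1)·u_{k−1}·(u₁)_q − (u_{k+1})_q for k = 1, …, n if and only if F satisfies the transport equation F_t + p·F_q − (u₁)_q·F_p = 0 for all (p,q,t) ∈ ℝ³. -/
/-- A polynomial function with coefficients listed in decreasing degree vanishes identically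
iff all its coefficients vanish. -/
theorem sum_Icc_mul_pow_sub_eq_zero_iff (n : ℕ) (e : ℕ → ℝ) :
    (∀ p : ℝ, ∑ k ∈ Finset.Icc 1 n, e k * p ^ (n - k) = 0) ↔ ∀ k ∈ Finset.Icc 1 n, e k = 0 := by
  refine ⟨fun h k hk => ?_, fun h p => Finset.sum_eq_zero fun k hk => by rw [h k hk, zero_mul]⟩
  have hP : ∑ j ∈ Finset.Icc 1 n, Polynomial.monomial (n - j) (e j) = 0 :=
    Polynomial.funext fun p => by simpa [Polynomial.eval_finsetSum] using h p
  have hc := congrArg (fun P => Polynomial.coeff P (n - k)) hP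
  simp only [Polynomial.finsetSum_coeff, Polynomial.coeff_monomial, Polynomial.coeff_zero] at hc
  rw [Finset.sum_eq_single_of_mem k hk, if_pos rfl] at hc
  · exact hc
  · intro j hj hjk
    rw [Finset.mem_Icc] at hj hk
    exact if_neg (by omega)

theorem sum_Icc_one_eq_sum_range (n : ℕ) (f : ℕ → ℝ) :
    ∑ k ∈ Finset.Icc 1 n, f k = ∑ i ∈ Finset.range n, f (i + 1) := by
  rw [Finset.range_eq_Ico, Finset.sum_Ico_add' f 0 n 1]
  rfl

/-- Collecting powers of `p` in the transport expression, where `v`, `vt`, `vq` stand for the values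
of the coefficients and of their partial derivatives. -/
theorem transport_expression_eq_sum (n : ℕ) (v vt vq : ℕ → ℝ) (hvq : vq (n + 1) = 0) (p : ℝ) :
    (∑ k ∈ Finset.Icc 1 n, vt k * p ^ (n - k)) + p * (∑ k ∈ Finset.Icc 1 n, vq k * p ^ (n - k))
      - vq 1 * (p ^ n + v 0 * (n * p ^ (n - 1))
        + ∑ k ∈ Finset.Icc 1 n, v k * (((n - k : ℕ) : ℝ) * p ^ (n - k - 1)))
    = ∑ k ∈ Finset.Icc 1 n,
      (vt k - (((n - k + 1 : ℕ) : ℝ) * v (k - 1) * vq 1 - vq (k + 1))) * p ^ (n - k) := by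
  have hq := Finset.sum_range_sub' (fun i => vq (i + 1) * p ^ (n - i)) n
  have hv := Finset.sum_range_sub' (fun i => v i * (((n - i : ℕ) : ℝ) * p ^ (n - i - 1))) n
  simp only [Nat.sub_zero, Nat.sub_self, Nat.cast_zero, zero_mul, mul_zero, sub_zero, zero_add,
    hvq, Finset.sum_sub_distrib] at hq hv
  have hq' : p * ∑ i ∈ Finset.range n, vq (i + 1) * p ^ (n - (i + 1))
      = ∑ i ∈ Finset.range n, vq (i + 1) * p ^ (n - i) := by
    rw [Finset.mul_sum]
    refine Finset.sum_congr rfl fun i hi => ?_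
    rw [Finset.mem_range] at hi
    rw [show n - i = n - (i + 1) + 1 by omega, pow_succ]
    ring
  have hv' : ∑ i ∈ Finset.range n, (vt (i + 1) - (((n - (i + 1) + 1 : ℕ) : ℝ) * v (i + 1 - 1) * vq 1
        - vq (i + 1 + 1))) * p ^ (n - (i + 1))
      = ∑ i ∈ Finset.range n, vt (i + 1) * p ^ (n - (i + 1))
        - vq 1 * ∑ i ∈ Finset.range n, v i * (((n - i : ℕ) : ℝ) * p ^ (n - i - 1))
        + ∑ i ∈ Finset.range n, vq (i + 1 + 1) * p ^ (n - (i + 1)) := by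
    rw [Finset.mul_sum, ← Finset.sum_sub_distrib, ← Finset.sum_add_distrib]
    refine Finset.sum_congr rfl fun i hi => ?_
    rw [Finset.mem_range] at hi
    rw [show n - (i + 1) + 1 = n - i by omega, Nat.add_sub_cancel, Nat.sub_sub]
    ring
  simp only [sum_Icc_one_eq_sum_range]
  rw [hq', hv']
  linear_combination hq + vq 1 * hv

/-- With `u₀` a constant parameter, `u₁, …, u_n` smooth and
`u_{n+1} ≡ 0`, set `F(p,q,t) = p^{n+1}/(n+1) + u₀·pⁿ + Σ_{k=1}^n u_k(q,t)·p^{n−k}`.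
Then the quasi-linear system `(u_k)_t = (n−k+1)·u_{k−1}·(u₁)_q − (u_{k+1})_q`
(`k = 1, …, n`) holds iff `F` satisfies the transport equation
`F_t + p·F_q − (u₁)_q·F_p = 0` on `ℝ³`. -/
theorem quasilinear_system_iff_transport_equation
    (n : ℕ) (hn : 1 ≤ n) (u₀ : ℝ) (u : ℕ → ℝ → ℝ → ℝ)
    (hu0 : ∀ q t, u 0 q t = u₀)
    (hutop : ∀ q t, u (n + 1) q t = 0)
    (husmooth : ∀ k ≤ n + 1, ContDiff ℝ (⊤ : ℕ∞) (fun x : ℝ × ℝ => u k x.1 x.2))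
    (F : ℝ → ℝ → ℝ → ℝ)
    (hF : ∀ p q t, F p q t =
      p ^ (n + 1) / (n + 1) + u₀ * p ^ n + ∑ k ∈ Finset.Icc 1 n, u k q t * p ^ (n - k)) :
    (∀ k ∈ Finset.Icc 1 n, ∀ q t,
        deriv (fun t' => u k q t') t =
          ((n - k + 1 : ℕ) : ℝ) * u (k - 1) q t * deriv (fun q' => u 1 q' t) q
            - deriv (fun q' => u (k + 1) q' t) q)
      ↔
    (∀ p q t,
        deriv (fun t' => F p q t') t + p * deriv (fun q' => F p q' t) q
          - deriv (fun q' => u 1 q' t) q * deriv (fun p' => F p' q t) p = 0) := by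
  have hdq : ∀ k ∈ Finset.Icc 1 n, ∀ q t, DifferentiableAt ℝ (fun q' => u k q' t) q := by
    intro k hk q t
    have h := (husmooth k (by rw [Finset.mem_Icc] at hk; omega)).differentiable (by simp)
    exact (h (q, t)).comp (f := fun q' : ℝ => (q', t)) q (by fun_prop)
  have hdt : ∀ k ∈ Finset.Icc 1 n, ∀ q t, DifferentiableAt ℝ (fun t' => u k q t') t := by
    intro k hk q t
    have h := (husmooth k (by rw [Finset.mem_Icc] at hk; omega)).differentiable (by simp)
    exact (h (q, t)).comp (f := fun t' : ℝ => (q, t')) t (by fun_prop)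
  have hFt : ∀ p q t, deriv (fun t' => F p q t') t
      = ∑ k ∈ Finset.Icc 1 n, deriv (fun t' => u k q t') t * p ^ (n - k) := by
    intro p q t
    simp only [hF]
    exact ((HasDerivAt.fun_sum fun k hk =>
      (hdt k hk q t).hasDerivAt.mul_const (p ^ (n - k))).const_add _).deriv
  have hFq : ∀ p q t, deriv (fun q' => F p q' t) q
      = ∑ k ∈ Finset.Icc 1 n, deriv (fun q' => u k q' t) q * p ^ (n - k) := by
    intro p q t
    simp only [hF]
    exact ((HasDerivAt.fun_sum fun k hk =>
      (hdq k hk q t).hasDerivAt.mul_const (p ^ (n - k))).const_add _).deriv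
  have hFp : ∀ p q t, deriv (fun p' => F p' q t) p
      = p ^ n + u 0 q t * (n * p ^ (n - 1))
        + ∑ k ∈ Finset.Icc 1 n, u k q t * (((n - k : ℕ) : ℝ) * p ^ (n - k - 1)) := by
    intro p q t
    simp only [hF, hu0]
    have hlead : HasDerivAt (fun p' : ℝ => p' ^ (n + 1) / ((n : ℝ) + 1)) (p ^ n) p := by
      have hn0 : (n : ℝ) + 1 ≠ 0 := by positivity
      refine ((hasDerivAt_pow (n + 1) p).div_const _).congr_deriv ?_
      rw [Nat.add_sub_cancel]
      push_cast
      field_simp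
    exact ((hlead.add ((hasDerivAt_pow n p).const_mul u₀)).add (HasDerivAt.fun_sum fun k _ =>
      (hasDerivAt_pow (n - k) p).const_mul (u k q t))).deriv
  have hexpr : ∀ p q t,
      deriv (fun t' => F p q t') t + p * deriv (fun q' => F p q' t) q
          - deriv (fun q' => u 1 q' t) q * deriv (fun p' => F p' q t) p
      = ∑ k ∈ Finset.Icc 1 n, (deriv (fun t' => u k q t') t
          - (((n - k + 1 : ℕ) : ℝ) * u (k - 1) q t * deriv (fun q' => u 1 q' t) q
            - deriv (fun q' => u (k + 1) q' t) q)) * p ^ (n - k) := by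
    intro p q t
    rw [hFt, hFq, hFp]
    exact transport_expression_eq_sum n (fun k => u k q t) (fun k => deriv (fun t' => u k q t') t)
      (fun k => deriv (fun q' => u k q' t) q) (by simp [hutop]) p
  simp only [hexpr]
  constructor
  · intro h p q t
    exact (sum_Icc_mul_pow_sub_eq_zero_iff n _).2 (fun k hk => sub_eq_zero.2 (h k hk q t)) p
  · intro h k hk q t
    exact sub_eq_zero.1 ((sum_Icc_mul_pow_sub_eq_zero_iff n _).1 (fun p => h p q t) k hk)
end

section
/- Let u : ℝ × ℝ → ℝ be C², 1-periodic in q, and let f : ℝ × ℝ × ℝ → ℝ, (α,q,t) ↦ f(α,q,t), be a C² function, 1-periodic in q, such that each f(α,·,·) solves f_t + f·f_q + u_q = 0 on ℝ² and for each fixed (q,t) the map α ↦ f(α,q,t) is a C² diffeomorphism of ℝ. Define ω : ℝ³ → ℝ by ω(f(α,q,t), q, t) = f_q(α,q,t) (i.e. ω(p,q,t) = f_q(α(p,q,t),q,t) where α(p,q,t) is the unique α with f(α,q,t) = p). Then ω is C¹, 1-periodic in q, and satisfies ω_t + p·ω_q − u_q·ω_p + ω² + u_qq = 0 everywhere. 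-/
/-- If a `C^n` function on `ℝ × E` is bijective in its first variable, with nonvanishing partial
derivative, then it can be solved for that variable by a `C^n` function. -/
theorem ContDiff.exists_contDiff_solution_fst {E : Type*} [NormedAddCommGroup E] [NormedSpace ℝ E]
    [CompleteSpace E] {n : WithTop ℕ∞} (hn : n ≠ 0) {F : ℝ × E → ℝ} (hF : ContDiff ℝ n F)
    (hbij : ∀ y, Function.Bijective fun a => F (a, y))
    (hne : ∀ x, fderiv ℝ F x (1, 0) ≠ 0) :
    ∃ G : ℝ × E → ℝ, ContDiff ℝ n G ∧ ∀ p y, F (G (p, y), y) = p := by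
  have hsplit : ∀ (A : ℝ × E →L[ℝ] ℝ) (v : ℝ × E), A v = v.1 * A (1, 0) + A (0, v.2) := by
    intro A v
    have h : v = v.1 • ((1, 0) : ℝ × E) + (0, v.2) := by ext <;> simp
    conv_lhs => rw [h, map_add, map_smul, smul_eq_mul]
  let L : ∀ x, (ℝ × E) ≃L[ℝ] (ℝ × E) := fun x =>
    ContinuousLinearEquiv.equivOfInverse
      ((fderiv ℝ F x).prod (ContinuousLinearMap.snd ℝ ℝ E))
      (((fderiv ℝ F x (1, 0))⁻¹ • (ContinuousLinearMap.fst ℝ ℝ E -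
        (fderiv ℝ F x).comp ((ContinuousLinearMap.inr ℝ ℝ E).comp
          (ContinuousLinearMap.snd ℝ ℝ E)))).prod (ContinuousLinearMap.snd ℝ ℝ E))
      (fun v => by
        ext
        · have := hne x
          simp [hsplit _ v]
          field_simp
        · simp)
      (fun v => by
        ext
        · have := hne x
          rw [ContinuousLinearMap.prod_apply, hsplit]
          simp
          field_simp
          ring
        · simp)
  have hΦ : ContDiff ℝ n fun x : ℝ × E => (F x, x.2) := hF.prodMk contDiff_snd
  have hd : ∀ x, HasStrictFDerivAt (fun x : ℝ × E => (F x, x.2))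
      (L x : (ℝ × E) →L[ℝ] (ℝ × E)) x := fun x =>
    (hF.contDiffAt.hasStrictFDerivAt hn).prodMk hasStrictFDerivAt_snd
  have hΦbij : Function.Bijective fun x : ℝ × E => (F x, x.2) := by
    refine ⟨?_, ?_⟩
    · rintro ⟨a, y⟩ ⟨b, z⟩ h
      obtain ⟨h1, rfl⟩ := Prod.mk.inj h
      exact congrArg (·, y) ((hbij y).1 h1)
    · rintro ⟨p, y⟩
      obtain ⟨a, ha⟩ := (hbij y).2 p
      exact ⟨(a, y), Prod.ext ha rfl⟩
  let e : (ℝ × E) ≃ₜ (ℝ × E) :=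
    (Equiv.ofBijective _ hΦbij).toHomeomorphOfContinuousOpen hΦ.continuous
      (isOpenMap_of_hasStrictFDerivAt_equiv hd)
  have hsymm : ContDiff ℝ n e.symm := e.contDiff_symm (fun x => (hd x).hasFDerivAt) hΦ
  refine ⟨fun x => (e.symm x).1, contDiff_fst.comp hsymm, fun p y => ?_⟩
  have h : (F (e.symm (p, y)), (e.symm (p, y)).2) = (p, y) := e.apply_symm_apply (p, y)
  obtain ⟨h1, h2⟩ := Prod.mk.inj h
  rwa [show e.symm (p, y) = ((e.symm (p, y)).1, y) from Prod.ext rfl h2] at h1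

/-- A differentiable function with a differentiable left inverse has nonvanishing derivative. -/
theorem deriv_ne_zero_of_leftInverse {g h : ℝ → ℝ} (hgh : Function.LeftInverse h g) {x : ℝ}
    (hg : DifferentiableAt ℝ g x) (hh : DifferentiableAt ℝ h (g x)) : deriv g x ≠ 0 := by
  intro h0
  have h1 := hh.hasDerivAt.comp x hg.hasDerivAt
  rw [show h ∘ g = id from funext hgh, h0, mul_zero] at h1
  exact zero_ne_one (h1.unique (hasDerivAt_id x))

theorem hasDerivAt_mk_fst {F : ℝ × ℝ × ℝ → ℝ} {a b c : ℝ} {A : ℝ × ℝ × ℝ →L[ℝ] ℝ}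
    (hF : HasFDerivAt F A (a, b, c)) : HasDerivAt (fun a' => F (a', b, c)) (A (1, 0, 0)) a :=
  hF.comp_hasDerivAt a ((hasDerivAt_id a).prodMk
    ((hasDerivAt_const a b).prodMk (hasDerivAt_const a c)))

theorem hasDerivAt_mk_snd_fst {F : ℝ × ℝ × ℝ → ℝ} {a b c : ℝ} {A : ℝ × ℝ × ℝ →L[ℝ] ℝ}
    (hF : HasFDerivAt F A (a, b, c)) : HasDerivAt (fun b' => F (a, b', c)) (A (0, 1, 0)) b :=
  hF.comp_hasDerivAt b ((hasDerivAt_const b a).prodMk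
    ((hasDerivAt_id b).prodMk (hasDerivAt_const b c)))

theorem hasDerivAt_mk_snd_snd {F : ℝ × ℝ × ℝ → ℝ} {a b c : ℝ} {A : ℝ × ℝ × ℝ →L[ℝ] ℝ}
    (hF : HasFDerivAt F A (a, b, c)) : HasDerivAt (fun c' => F (a, b, c')) (A (0, 0, 1)) c :=
  hF.comp_hasDerivAt c ((hasDerivAt_const c a).prodMk
    ((hasDerivAt_const c b).prodMk (hasDerivAt_id c)))


/-- Let `u(q,t)` be `C²`, `1`-periodic in `q`, and `f(α,q,t)` a `C²`
family, `1`-periodic in `q`, of solutions of `f_t + f·f_q + u_q = 0` such that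
`α ↦ f(α,q,t)` is a `C²` diffeomorphism of `ℝ` for each `(q,t)`.  Define `ω(p,q,t)` by
the rule `ω(f(α,q,t), q, t) = f_q(α,q,t)` (the slope of the leaf through `(p,q)` at
time `t`).  Then `ω` is `C¹`, `1`-periodic in `q`, and satisfies the Riccati-type
equation `ω_t + p·ω_q − u_q·ω_p + ω² + u_qq = 0` everywhere. -/
theorem slope_function_of_foliation_satisfies_riccati
    (u : ℝ → ℝ → ℝ) (hu : ContDiff ℝ 2 (fun x : ℝ × ℝ => u x.1 x.2))
    (huper : ∀ q t, u (q + 1) t = u q t)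
    (uq uqq : ℝ → ℝ → ℝ)
    (huq : ∀ q t, HasDerivAt (fun q' => u q' t) (uq q t) q)
    (huqq : ∀ q t, HasDerivAt (fun q' => uq q' t) (uqq q t) q)
    (f : ℝ → ℝ → ℝ → ℝ)
    (hf : ContDiff ℝ 2 (fun x : ℝ × ℝ × ℝ => f x.1 x.2.1 x.2.2))
    (hfper : ∀ α q t, f α (q + 1) t = f α q t)
    (hburgers : ∀ α q t,
      deriv (fun t' => f α q t') t + f α q t * deriv (fun q' => f α q' t) q + uq q t = 0)
    (hdiffeo : ∀ q t, Function.Bijective (fun α => f α q t) ∧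
      ContDiff ℝ 2 (Function.invFun (fun α => f α q t)))
    (ω : ℝ → ℝ → ℝ → ℝ)
    (hω : ∀ α q t, ω (f α q t) q t = deriv (fun q' => f α q' t) q) :
    ContDiff ℝ 1 (fun x : ℝ × ℝ × ℝ => ω x.1 x.2.1 x.2.2) ∧
    (∀ p q t, ω p (q + 1) t = ω p q t) ∧
    (∀ p q t,
      deriv (fun t' => ω p q t') t + p * deriv (fun q' => ω p q' t) q
        - uq q t * deriv (fun p' => ω p' q t) p + (ω p q t) ^ 2 + uqq q t = 0) := by
  let F : ℝ × ℝ × ℝ → ℝ := fun x => f x.1 x.2.1 x.2.2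
  let Ω : ℝ × ℝ × ℝ → ℝ := fun x => ω x.1 x.2.1 x.2.2
  have hFd : ∀ x, HasFDerivAt F (fderiv ℝ F x) x := fun x =>
    (hf.differentiable two_ne_zero x).hasFDerivAt
  have hF' : ContDiff ℝ 1 (fderiv ℝ F) := hf.fderiv_right (by norm_num)
  have hα : ∀ α q t, HasDerivAt (fun α' => f α' q t) (fderiv ℝ F (α, q, t) (1, 0, 0)) α :=
    fun α q t => hasDerivAt_mk_fst (hFd (α, q, t))
  have hq : ∀ α q t, HasDerivAt (fun q' => f α q' t) (fderiv ℝ F (α, q, t) (0, 1, 0)) q :=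
    fun α q t => hasDerivAt_mk_snd_fst (hFd (α, q, t))
  have ht : ∀ α q t, HasDerivAt (fun t' => f α q t') (fderiv ℝ F (α, q, t) (0, 0, 1)) t :=
    fun α q t => hasDerivAt_mk_snd_snd (hFd (α, q, t))
  have hω' : ∀ α q t, ω (f α q t) q t = fderiv ℝ F (α, q, t) (0, 1, 0) := fun α q t =>
    (hω α q t).trans (hq α q t).deriv
  obtain ⟨G, hG, hFG⟩ := hf.exists_contDiff_solution_fst two_ne_zero
    (fun y => (hdiffeo y.1 y.2).1) (fun x => by
      have h := deriv_ne_zero_of_leftInverse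
        (Function.leftInverse_invFun (hdiffeo x.2.1 x.2.2).1.injective)
        (hα x.1 x.2.1 x.2.2).differentiableAt
        ((hdiffeo x.2.1 x.2.2).2.differentiable two_ne_zero _)
      rwa [(hα _ _ _).deriv] at h)
  have hΩ : ContDiff ℝ 1 Ω := by
    have hΩG : Ω = fun x => fderiv ℝ F (G x, x.2) (0, 1, 0) := by
      funext ⟨p, q, t⟩
      have h := hω' (G (p, q, t)) q t
      rwa [show f (G (p, q, t)) q t = p from hFG p (q, t)] at h
    rw [hΩG]
    exact (hF'.comp ((hG.of_le one_le_two).prodMk contDiff_snd)).clm_apply contDiff_const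
  refine ⟨hΩ, fun p q t => ?_, fun p q t => ?_⟩
  · obtain ⟨α, rfl⟩ := (hdiffeo q t).1.2 p
    have h := hω α (q + 1) t
    rw [hfper] at h
    simp only [h, hω]
    rw [← deriv_comp_add_const]
    simp only [hfper]
  · obtain ⟨α, rfl⟩ := (hdiffeo q t).1.2 p
    beta_reduce
    set B := fderiv ℝ (fderiv ℝ F) (α, q, t)
    set A := fderiv ℝ Ω (f α q t, q, t)
    have hΩd : HasFDerivAt Ω A (f α q t, q, t) :=
      (hΩ.differentiable one_ne_zero _).hasFDerivAt
    have hBd : ∀ v, HasFDerivAt (fun x => fderiv ℝ F x v) (B.flip v) (α, q, t) := fun v => by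
      simpa using (hF'.differentiable one_ne_zero (α, q, t)).hasFDerivAt.clm_apply
        (hasFDerivAt_const v _)
    have hsymm : B (0, 0, 1) (0, 1, 0) = B (0, 1, 0) (0, 0, 1) :=
      (hf.contDiffAt.isSymmSndFDerivAt (by simp)) _ _
    have hAq : A (fderiv ℝ F (α, q, t) (0, 1, 0), 1, 0) = B (0, 1, 0) (0, 1, 0) := by
      have h := hΩd.comp_hasDerivAt q
        ((hq α q t).prodMk ((hasDerivAt_id q).prodMk (hasDerivAt_const q t)))
      refine h.unique ?_
      refine (hasDerivAt_mk_snd_fst (hBd (0, 1, 0))).congr_of_eventuallyEq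
        (.of_forall fun q' => ?_)
      exact hω' α q' t
    have hAt : A (fderiv ℝ F (α, q, t) (0, 0, 1), 0, 1) = B (0, 0, 1) (0, 1, 0) := by
      have h := hΩd.comp_hasDerivAt t
        ((ht α q t).prodMk ((hasDerivAt_const t q).prodMk (hasDerivAt_id t)))
      refine h.unique ?_
      refine (hasDerivAt_mk_snd_snd (hBd (0, 1, 0))).congr_of_eventuallyEq
        (.of_forall fun t' => ?_)
      exact hω' α q t'
    have hburgers' : ∀ q', fderiv ℝ F (α, q', t) (0, 0, 1)
        + f α q' t * fderiv ℝ F (α, q', t) (0, 1, 0) + uq q' t = 0 := fun q' => by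
      rw [← (hq α q' t).deriv, ← (ht α q' t).deriv]
      exact hburgers α q' t
    have hburgers_q : B (0, 1, 0) (0, 0, 1) + (fderiv ℝ F (α, q, t) (0, 1, 0)
        * fderiv ℝ F (α, q, t) (0, 1, 0) + f α q t * B (0, 1, 0) (0, 1, 0)) + uqq q t = 0 := by
      have h := ((hasDerivAt_mk_snd_fst (hBd (0, 0, 1))).add
        ((hq α q t).mul (hasDerivAt_mk_snd_fst (hBd (0, 1, 0))))).add (huqq q t)
      exact h.unique ((hasDerivAt_const q (0 : ℝ)).congr_of_eventuallyEq (.of_forall hburgers'))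
    have hAsplit : ∀ a b c : ℝ,
        A (a, b, c) = a * A (1, 0, 0) + b * A (0, 1, 0) + c * A (0, 0, 1) := fun a b c => by
      simp only [← smul_eq_mul, ← map_smul, ← map_add]
      simp
    rw [(hasDerivAt_mk_fst hΩd).deriv, (hasDerivAt_mk_snd_fst hΩd).deriv,
      (hasDerivAt_mk_snd_snd hΩd).deriv, hω']
    rw [hAsplit] at hAq hAt
    linear_combination hAt + f α q t * hAq + hsymm + hburgers_q - A (1, 0, 0) * hburgers' q
end
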